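/- The sumset L + U₀ + U₀ equals ℕ \ {0, 2}; that is, a natural number n can be written as n = a + b + c with a ∈ L and b, c ∈ U₀ if and only if n ∉ {0, 2}. -/

import Mathlib

noncomputable def phi : ℝ := (1 + Real.sqrt 5) / 2

/-- The lower Wythoff set `L = {⌊i·φ⌋ : i ≥ 1}`. -/
def lowerWythoff : Set ℕ := {n | ∃ i : ℕ, 1 ≤ i ∧ n = ⌊(i : ℝ) * phi⌋₊}

/-- The upper Wythoff set `U = {⌊i·φ²⌋ : i ≥ 1}`. -/
def upperWythoff : Set ℕ := {n | ∃ i : ℕ, 1 ≤ i ∧ n = ⌊(i : ℝ) * phi ^ 2⌋₊}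

theorem phi_sq : phi ^ 2 = phi + 1 := by
  have h : Real.sqrt 5 ^ 2 = 5 := Real.sq_sqrt (by norm_num)
  unfold phi
  linarith

theorem phi_gt : 1.61 < phi := by
  have h : (2.22 : ℝ) < Real.sqrt 5 := Real.lt_sqrt_of_sq_lt (by norm_num)
  unfold phi
  linarith

theorem phi_lt : phi < 1.62 := by
  have h : Real.sqrt 5 < 2.24 := (Real.sqrt_lt' (by norm_num)).2 (by norm_num)
  unfold phi
  linarith

theorem mem_lowerWythoff_iff {m : ℕ} :
    m ∈ lowerWythoff ↔ ∃ i : ℕ, 1 ≤ i ∧ (m : ℝ) ≤ i * phi ∧ (i : ℝ) * phi < m + 1 := by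
  refine exists_congr fun i => and_congr_right fun _ => ?_
  have h0 : 0 ≤ (i : ℝ) * phi := mul_nonneg i.cast_nonneg (by linarith [phi_gt])
  rw [eq_comm, Nat.floor_eq_iff h0]

theorem pos_of_mem_lowerWythoff {m : ℕ} (h : m ∈ lowerWythoff) : 1 ≤ m := by
  obtain ⟨i, hi, -, h⟩ := mem_lowerWythoff_iff.1 h
  have hi' : (1 : ℝ) ≤ i := by exact_mod_cast hi
  have : (0 : ℝ) < m := by nlinarith [phi_gt]
  exact_mod_cast this

theorem two_notMem_lowerWythoff : 2 ∉ lowerWythoff := by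
  intro h
  obtain ⟨i, hi, h₁, h₂⟩ := mem_lowerWythoff_iff.1 h
  push_cast at h₁ h₂
  rcases hi.eq_or_lt with rfl | hi
  · push_cast at h₁
    linarith [phi_lt]
  · have hi' : (2 : ℝ) ≤ i := by exact_mod_cast hi
    nlinarith [phi_gt]

theorem one_notMem_upperWythoff_union_zero : 1 ∉ upperWythoff ∪ {0} := by
  rintro (⟨i, hi, h⟩ | h)
  · have hi' : (1 : ℝ) ≤ i := by exact_mod_cast hi
    have : 2 ≤ ⌊(i : ℝ) * phi ^ 2⌋₊ := by
      apply Nat.le_floor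
      rw [phi_sq]
      push_cast
      nlinarith [phi_gt]
    omega
  · simp at h

theorem two_mem_upperWythoff : 2 ∈ upperWythoff := by
  have h₁ := phi_gt
  have h₂ := phi_lt
  refine ⟨1, le_rfl, ?_⟩
  rw [eq_comm, Nat.floor_eq_iff (by positivity), phi_sq]
  push_cast
  constructor <;> linarith

theorem mem_lowerWythoff_or_add_two_or_add_four (m : ℕ) :
    m ∈ lowerWythoff ∨ m + 2 ∈ lowerWythoff ∨ m + 4 ∈ lowerWythoff := by
  have h₁ := phi_gt
  have h₂ := phi_lt
  have hpos : 0 < phi := by linarith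
  have hlo : (m : ℝ) < (⌊m / phi⌋₊ + 1) * phi := (div_lt_iff₀ hpos).1 (Nat.lt_floor_add_one _)
  have hhi : (⌊m / phi⌋₊ : ℝ) * phi ≤ m := (le_div_iff₀ hpos).1 (Nat.floor_le (by positivity))
  set k := ⌊m / phi⌋₊
  simp only [mem_lowerWythoff_iff]
  by_cases hs : ((k : ℝ) + 1) * phi < m + 1
  · exact Or.inl ⟨k + 1, by omega, by push_cast; linarith, by push_cast; linarith⟩
  · by_cases hs' : ((k : ℝ) + 2) * phi < m + 3
    · exact Or.inr (Or.inl ⟨k + 2, by omega, by push_cast; linarith, by push_cast; linarith⟩)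
    · exact Or.inr (Or.inr ⟨k + 3, by omega, by push_cast; linarith, by push_cast; linarith⟩)

theorem one_mem_lowerWythoff : 1 ∈ lowerWythoff :=
  mem_lowerWythoff_iff.2
    ⟨1, le_rfl, by push_cast; linarith [phi_gt], by push_cast; linarith [phi_lt]⟩

theorem three_mem_lowerWythoff : 3 ∈ lowerWythoff :=
  mem_lowerWythoff_iff.2
    ⟨2, by norm_num, by push_cast; linarith [phi_gt], by push_cast; linarith [phi_lt]⟩

/-- Theorem 3.7(iv): `L + U₀ + U₀ = ℕ \ {0, 2}`. -/
theorem lower_add_upper0_add_upper0 (n : ℕ) :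
    (∃ a ∈ lowerWythoff, ∃ b ∈ upperWythoff ∪ {0}, ∃ c ∈ upperWythoff ∪ {0},
        n = a + b + c) ↔
      n ∉ ({0, 2} : Set ℕ) := by
  simp only [Set.mem_insert_iff, Set.mem_singleton_iff, not_or]
  constructor
  · rintro ⟨a, ha, b, hb, c, hc, rfl⟩
    have ha₁ := pos_of_mem_lowerWythoff ha
    have ha₂ : a ≠ 2 := fun h => two_notMem_lowerWythoff (h ▸ ha)
    have hb₁ : b ≠ 1 := fun h => one_notMem_upperWythoff_union_zero (h ▸ hb)
    have hc₁ : c ≠ 1 := fun h => one_notMem_upperWythoff_union_zero (h ▸ hc)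
    omega
  · rintro ⟨h0, h2⟩
    have hz : 0 ∈ upperWythoff ∪ {0} := Or.inr rfl
    have ht : 2 ∈ upperWythoff ∪ {0} := Or.inl two_mem_upperWythoff
    by_cases hn : 4 ≤ n
    · obtain ⟨m, rfl⟩ := Nat.exists_eq_add_of_le' hn
      rcases mem_lowerWythoff_or_add_two_or_add_four m with h | h | h
      · exact ⟨m, h, 2, ht, 2, ht, rfl⟩
      · exact ⟨m + 2, h, 2, ht, 0, hz, rfl⟩
      · exact ⟨m + 4, h, 0, hz, 0, hz, rfl⟩
    · obtain rfl | rfl : n = 1 ∨ n = 3 := by omega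
      · exact ⟨1, one_mem_lowerWythoff, 0, hz, 0, hz, rfl⟩
      · exact ⟨3, three_mem_lowerWythoff, 0, hz, 0, hz, rfl⟩
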